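/- Let G be a finite undirected graph (possibly with loops) with no isolated vertices, and let K°_k denote the complete graph with loops on k vertices (every pair of vertices, including each vertex with itself, is adjacent). Then h(G ∇ K°_k) = h(G) + k, where G ∇ K°_k is the join of G and K°_k. -/

import Mathlib

/-- `nbhd adj A` is the set of vertices having at least one neighbor in `A`
(for the symmetric adjacency relation `adj`, which may have loops). -/
def nbhd {V : Type*} (adj : V → V → Prop) (A : Set V) : Set V :=
  {v | ∃ u ∈ A, adj u v}

/-- Rabbit territory at (0-indexed) time `t` against the hunter strategy `W`,
when the rabbit may start anywhere in `S`.  (`terr adj S W (t-1)` is the set `R_t`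
of the paper: `R_1 = S \ W_1`, `R_t = N(R_{t-1}) \ W_t`.) -/
def terr {V : Type*} (adj : V → V → Prop) (S : Set V) (W : ℕ → Set V) : ℕ → Set V
  | 0 => S \ W 0
  | t + 1 => nbhd adj (terr adj S W t) \ W (t + 1)

/-- The hunter strategy `W` uses at most `k` hunters. -/
def UsesAtMost {V : Type*} (W : ℕ → Set V) (k : ℕ) : Prop :=
  ∀ t, (W t).ncard ≤ k

/-- The hunting number when the rabbit is restricted to start in `S`:
the least `k` for which some strategy using `k` hunters empties the territory. -/
noncomputable def huntingNumberFrom {V : Type*} (adj : V → V → Prop) (S : Set V) : ℕ :=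
  sInf {k | ∃ W : ℕ → Set V, UsesAtMost W k ∧ ∃ T, terr adj S W T = ∅}

/-- The hunting number `h(G)`. -/
noncomputable def huntingNumber {V : Type*} (adj : V → V → Prop) : ℕ :=
  huntingNumberFrom adj Set.univ

/-- The hunting number with time limit `l ≥ 1`, `h(G,l)`:
the strategy `W_1, …, W_l` corresponds to indices `0, …, l-1`, and the rabbit must be
caught by round `l`, i.e. `R_l = terr … (l-1) = ∅`. -/
noncomputable def huntingNumberTL {V : Type*} (adj : V → V → Prop) (l : ℕ) : ℕ :=
  sInf {k | ∃ W : ℕ → Set V, UsesAtMost W k ∧ terr adj Set.univ W (l - 1) = ∅}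

/-- The join `G ∇ H` of two graphs: disjoint union plus all edges between the two sides. -/
def adjJoin {V U : Type*} (adjG : V → V → Prop) (adjH : U → U → Prop) :
    V ⊕ U → V ⊕ U → Prop
  | Sum.inl a, Sum.inl b => adjG a b
  | Sum.inr a, Sum.inr b => adjH a b
  | Sum.inl _, Sum.inr _ => True
  | Sum.inr _, Sum.inl _ => True

theorem terr_congr {V : Type*} (adj : V → V → Prop) (S : Set V) {W W' : ℕ → Set V} {s : ℕ}
    (h : ∀ r ≤ s, W r = W' r) : terr adj S W s = terr adj S W' s := by
  induction s with
  | zero => simp [terr, h 0 le_rfl]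
  | succ s ih => simp only [terr, ih fun r hr => h r (by omega), h (s + 1) le_rfl]

/-- On a finite graph, the hunting number is attained by a winning strategy. -/
theorem exists_strategy_huntingNumber {V : Type*} [Finite V] (adj : V → V → Prop) :
    ∃ W : ℕ → Set V, UsesAtMost W (huntingNumber adj) ∧ ∃ T, terr adj Set.univ W T = ∅ :=
  Nat.sInf_mem (s := {k | ∃ W : ℕ → Set V, UsesAtMost W k ∧ ∃ T, terr adj Set.univ W T = ∅})
    ⟨(Set.univ : Set V).ncard, fun _ => Set.univ, fun _ => le_rfl, 0, by simp [terr]⟩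

theorem huntingNumber_le {V : Type*} {adj : V → V → Prop} {W : ℕ → Set V} {m T : ℕ}
    (hW : UsesAtMost W m) (hT : terr adj Set.univ W T = ∅) : huntingNumber adj ≤ m :=
  Nat.sInf_le ⟨W, hW, T, hT⟩

theorem ncard_image_inl_union_range_inr {V : Type*} [Finite V] {k : ℕ} (A : Set V) :
    (Sum.inl '' A ∪ Set.range (Sum.inr : Fin k → V ⊕ Fin k)).ncard = A.ncard + k := by
  rw [Set.ncard_union_eq (by simp [Set.disjoint_left]) (Set.toFinite _) (Set.toFinite _),
    Set.ncard_image_of_injective _ Sum.inl_injective, ← Set.image_univ,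
    Set.ncard_image_of_injective _ Sum.inr_injective, Set.ncard_univ, Nat.card_fin]

theorem eq_image_inl_union_range_inr {V U : Type*} {B : Set (V ⊕ U)}
    (h : ∀ i, Sum.inr i ∈ B) : B = Sum.inl '' (Sum.inl ⁻¹' B) ∪ Set.range Sum.inr := by
  ext (v | i) <;> simp [h]

theorem nbhd_adjJoin_image_inl_diff {V U : Type*} (adj : V → V → Prop) (adjU : U → U → Prop)
    (A : Set V) {B : Set (V ⊕ U)} (h : ∀ i, Sum.inr i ∈ B) :
    nbhd (adjJoin adj adjU) (Sum.inl '' A) \ B = Sum.inl '' (nbhd adj A \ Sum.inl ⁻¹' B) := by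
  ext (v | i) <;> simp [h, nbhd, adjJoin]

theorem univ_diff_eq_image_inl {V U : Type*} {B : Set (V ⊕ U)} (h : ∀ i, Sum.inr i ∈ B) :
    Set.univ \ B = Sum.inl '' (Set.univ \ Sum.inl ⁻¹' B) := by
  ext (v | i) <;> simp [h]

theorem nbhd_adjJoin_of_inr_mem {V : Type*} (adj : V → V → Prop) {k : ℕ}
    {A : Set (V ⊕ Fin k)} {i : Fin k} (h : Sum.inr i ∈ A) :
    nbhd (adjJoin adj (fun _ _ : Fin k => True)) A = Set.univ := by
  ext (v | j) <;> simp only [nbhd, Set.mem_ofPred_eq, Set.mem_univ, iff_true] <;>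
    exact ⟨_, h, trivial⟩

theorem huntingNumber_adjJoin_le {V : Type*} [Finite V] (adj : V → V → Prop) (k : ℕ) :
    huntingNumber (adjJoin adj (fun _ _ : Fin k => True)) ≤ huntingNumber adj + k := by
  obtain ⟨W, hW, T, hT⟩ := exists_strategy_huntingNumber adj
  let W' : ℕ → Set (V ⊕ Fin k) := fun t => Sum.inl '' W t ∪ Set.range Sum.inr
  have hmem (t : ℕ) (i : Fin k) : Sum.inr i ∈ W' t := by simp [W']
  have hpre (t : ℕ) : Sum.inl ⁻¹' W' t = W t := by ext; simp [W']
  have hterr (t : ℕ) : terr (adjJoin adj (fun _ _ : Fin k => True)) Set.univ W' t =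
      Sum.inl '' terr adj Set.univ W t := by
    induction t with
    | zero => rw [terr, univ_diff_eq_image_inl (hmem 0), hpre, terr]
    | succ t ih => rw [terr, ih, nbhd_adjJoin_image_inl_diff _ _ _ (hmem _), hpre, terr]
  refine huntingNumber_le (W := W') (T := T) (fun t => ?_) (by rw [hterr, hT, Set.image_empty])
  rw [ncard_image_inl_union_range_inr]
  exact Nat.add_le_add_right (hW t) k

/-- Against any strategy with `m` hunters on the join, as long as `m - k` hunters do not win
on `G`, the territory either meets `K°_k` or is a territory of `G` against `m - k` hunters. -/
theorem inr_mem_terr_adjJoin_or {V : Type*} [Finite V] (adj : V → V → Prop) {k m : ℕ}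
    {W : ℕ → Set (V ⊕ Fin k)} (hW : UsesAtMost W m) (hm : m < huntingNumber adj + k) (t : ℕ) :
    (∃ i, Sum.inr i ∈ terr (adjJoin adj (fun _ _ : Fin k => True)) Set.univ W t) ∨
      ∃ (U : ℕ → Set V) (s : ℕ), (∀ r, (U r).ncard + k ≤ m) ∧
        terr (adjJoin adj (fun _ _ : Fin k => True)) Set.univ W t =
          Sum.inl '' terr adj Set.univ U s := by
  have hcard {t : ℕ} (h : ∀ i, Sum.inr i ∈ W t) : (Sum.inl ⁻¹' W t).ncard + k ≤ m := by
    rw [← ncard_image_inl_union_range_inr, ← eq_image_inl_union_range_inr h]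
    exact hW t
  have restart {t : ℕ} (h : ∀ i, Sum.inr i ∈ W t) : ∃ (U : ℕ → Set V) (s : ℕ),
      (∀ r, (U r).ncard + k ≤ m) ∧ Set.univ \ W t = Sum.inl '' terr adj Set.univ U s :=
    ⟨fun _ => Sum.inl ⁻¹' W t, 0, fun _ => hcard h, univ_diff_eq_image_inl h⟩
  rw [or_iff_not_imp_left]
  intro hno
  push Not at hno
  induction t with
  | zero => exact restart fun i => by simpa [terr] using hno i
  | succ t ih =>
    by_cases hi : ∃ i, Sum.inr i ∈ terr (adjJoin adj (fun _ _ : Fin k => True)) Set.univ W t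
    · obtain ⟨i, hi⟩ := hi
      simp only [terr, nbhd_adjJoin_of_inr_mem adj hi] at hno ⊢
      exact restart fun i => by simpa using hno i
    · push Not at hi
      obtain ⟨U, s, hU, hs⟩ := ih hi
      obtain ⟨v, hv⟩ : (terr adj Set.univ U s).Nonempty := by
        by_contra hempty
        have := huntingNumber_le (m := m - k) (fun r => by have := hU r; omega)
          (Set.not_nonempty_iff_eq_empty.mp hempty)
        have := hU 0
        omega
      have hmem (i : Fin k) : Sum.inr i ∈ W (t + 1) := by
        by_contra hiW
        exact hno i ⟨⟨Sum.inl v, hs ▸ Set.mem_image_of_mem _ hv, trivial⟩, hiW⟩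
      refine ⟨fun r => if r ≤ s then U r else Sum.inl ⁻¹' W (t + 1), s + 1, fun r => ?_, ?_⟩
      · dsimp only
        split_ifs
        exacts [hU r, hcard hmem]
      · rw [terr, hs, nbhd_adjJoin_image_inl_diff _ _ _ hmem, terr,
          terr_congr adj Set.univ (W' := U) fun r hr => if_pos hr, if_neg (by omega)]

theorem le_huntingNumber_adjJoin {V : Type*} [Finite V] (adj : V → V → Prop) (k : ℕ) :
    huntingNumber adj + k ≤ huntingNumber (adjJoin adj (fun _ _ : Fin k => True)) := by
  obtain ⟨W, hW, T, hT⟩ :=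
    exists_strategy_huntingNumber (adjJoin adj (fun _ _ : Fin k => True))
  by_contra! hlt
  obtain ⟨i, hi⟩ | ⟨U, s, hU, hs⟩ := inr_mem_terr_adjJoin_or adj hW hlt T
  · simp [hT] at hi
  · have := huntingNumber_le (m := _ - k) (fun r => Nat.le_sub_of_add_le (hU r))
      (Set.image_eq_empty.mp (hs.symm.trans hT))
    have := hU 0
    omega


/-- joining `G` with the complete graph with loops `K°_k`
(adjacency on `Fin k` is the full relation, loops included) adds exactly `k`
to the hunting number: `h(G ∇ K°_k) = h(G) + k`. -/
theorem hunting_number_join_complete_with_loops {V : Type*} [Fintype V]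
    (adj : V → V → Prop) (hsymm : Symmetric adj) (hniso : ∀ v, ∃ u, adj v u) (k : ℕ) :
    huntingNumber (adjJoin adj (fun _ _ : Fin k => True)) = huntingNumber adj + k := by
  exact le_antisymm (huntingNumber_adjJoin_le adj k) (le_huntingNumber_adjJoin adj k)
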